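/- arXiv:2303.02942 — 2 statements merged into one kernel-verified Lean document; each statement's English description precedes it below -/
import Mathlib

section
/- For all (x, y) with 0 ≤ x ≤ 0.8, 0 ≤ y ≤ 0.8, and 0.5 ≤ x + y ≤ 1.2, one has f_11(x, y) ≥ −8×10⁻⁹; that is, on this region (which contains all serve-win probability pairs typical of high-level play) the disadvantage of the first-serving team in a side-out scoring game to 11 never exceeds 8×10⁻⁹ in absolute value. -/
/-- The four server designations in side-out scoring: Team A's first and second
servers and Team B's first and second servers. -/
inductive SOSrv : Type
  | A1 | A2 | B1 | B2
  deriving DecidableEq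

/-- States of a game to `n` with four server designations: a (capped) score `(i, j)`
together with a server designation, or one of the two absorbing states. -/
inductive SOState (n : ℕ) : Type
  | game (i j : ℕ) (srv : SOSrv)
  | Awins
  | Bwins
  deriving DecidableEq

/-- The capped scores of a game to `n`: both scores at most `n - 1`, or one of the two
advantage scores `(n - 1, n)`, `(n, n - 1)`. -/
def validScore (n i j : ℕ) : Prop :=
  (i ≤ n - 1 ∧ j ≤ n - 1) ∨ (i = n - 1 ∧ j = n) ∨ (i = n ∧ j = n - 1)

/-- Result of Team A scoring a point from (capped) score `(i, j)`, with server `srv`: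
from deuce `(n-1, n-1)` to advantage `(n, n-1)`; from Team B's advantage `(n-1, n)`
back to deuce; from advantage `(n, n-1)` or from `(n-1, j)` with `j ≤ n-2`, Team A wins;
otherwise the score is incremented. -/
def soScoreA (n i j : ℕ) (srv : SOSrv) : SOState n :=
  if i = n - 1 then
    if j = n - 1 then SOState.game n (n - 1) srv
    else if j = n then SOState.game (n - 1) (n - 1) srv
    else SOState.Awins
  else if i = n then SOState.Awins
  else SOState.game (i + 1) j srv

/-- Result of Team B scoring a point from (capped) score `(i, j)`, with server `srv`. -/
def soScoreB (n i j : ℕ) (srv : SOSrv) : SOState n :=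
  if j = n - 1 then
    if i = n - 1 then SOState.game (n - 1) n srv
    else if i = n then SOState.game (n - 1) (n - 1) srv
    else SOState.Bwins
  else if j = n then SOState.Bwins
  else SOState.game i (j + 1) srv

/-- `soDist n pA pB k s t` : the probability that a side-out scoring game to `n` is in
state `t` after `k` rallies, starting from state `s`.  When Team A serves it wins the
rally with probability `pA` (scoring a point and keeping the server); otherwise the
server designation advances `A1 → A2 → B1 → B2 → A1` (side out after two faults;
the game starts with the first-serving team's second server).  Similarly for Team B
with `pB`.  The absorbing states stay put. -/
def soDist (n : ℕ) (pA pB : ℝ) : ℕ → SOState n → SOState n → ℝ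
  | 0, s, t => if t = s then 1 else 0
  | k + 1, SOState.Awins, t => soDist n pA pB k SOState.Awins t
  | k + 1, SOState.Bwins, t => soDist n pA pB k SOState.Bwins t
  | k + 1, SOState.game i j SOSrv.A1, t =>
      pA * soDist n pA pB k (soScoreA n i j SOSrv.A1) t
        + (1 - pA) * soDist n pA pB k (SOState.game i j SOSrv.A2) t
  | k + 1, SOState.game i j SOSrv.A2, t =>
      pA * soDist n pA pB k (soScoreA n i j SOSrv.A2) t
        + (1 - pA) * soDist n pA pB k (SOState.game i j SOSrv.B1) t
  | k + 1, SOState.game i j SOSrv.B1, t =>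
      pB * soDist n pA pB k (soScoreB n i j SOSrv.B1) t
        + (1 - pB) * soDist n pA pB k (SOState.game i j SOSrv.B2) t
  | k + 1, SOState.game i j SOSrv.B2, t =>
      pB * soDist n pA pB k (soScoreB n i j SOSrv.B2) t
        + (1 - pB) * soDist n pA pB k (SOState.game i j SOSrv.A1) t

/-- Probability that Team A eventually wins the side-out scoring game, from state `s`. -/
noncomputable def soWinA (n : ℕ) (pA pB : ℝ) (s : SOState n) : ℝ :=
  ⨆ k : ℕ, soDist n pA pB k s SOState.Awins

/-- Probability that Team B eventually wins the side-out scoring game, from state `s`. -/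
noncomputable def soWinB (n : ℕ) (pA pB : ℝ) (s : SOState n) : ℝ :=
  ⨆ k : ℕ, soDist n pA pB k s SOState.Bwins

/-- The first-serving team's advantage `f_n(p_A, p_B)` under side-out scoring to `n`:
P(Team A wins | Team A serves first) − P(Team A wins | Team B serves first).
The game starts at score 0-0 with the first-serving team's second server. -/
noncomputable def soAdv (n : ℕ) (pA pB : ℝ) : ℝ :=
  soWinA n pA pB (SOState.game 0 0 SOSrv.A2) - soWinA n pA pB (SOState.game 0 0 SOSrv.B2)

section WinProbability

variable {n : ℕ} {x y : ℝ}

lemma soDist_mem_Icc (hx0 : 0 ≤ x) (hx1 : x ≤ 1) (hy0 : 0 ≤ y) (hy1 : y ≤ 1) (k : ℕ)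
    (s t : SOState n) : soDist n x y k s t ∈ Set.Icc (0 : ℝ) 1 := by
  have convex : ∀ {c a b : ℝ}, 0 ≤ c → c ≤ 1 → a ∈ Set.Icc (0 : ℝ) 1 → b ∈ Set.Icc (0 : ℝ) 1 →
      c * a + (1 - c) * b ∈ Set.Icc (0 : ℝ) 1 := by
    rintro c a b h0 h1 ⟨ha0, ha1⟩ ⟨hb0, hb1⟩
    constructor <;> nlinarith
  induction k generalizing s with
  | zero => simp only [soDist]; split_ifs <;> simp
  | succ k ih =>
    rcases s with ⟨i, j, _ | _ | _ | _⟩ | _ | _ <;> simp only [soDist]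
    · exact convex hx0 hx1 (ih _) (ih _)
    · exact convex hx0 hx1 (ih _) (ih _)
    · exact convex hy0 hy1 (ih _) (ih _)
    · exact convex hy0 hy1 (ih _) (ih _)
    · exact ih _
    · exact ih _

lemma soDist_Awins_Awins (k : ℕ) :
    soDist n x y k SOState.Awins SOState.Awins = 1 := by
  induction k with
  | zero => simp [soDist]
  | succ k ih => simpa [soDist] using ih

lemma soDist_Bwins_Awins (k : ℕ) :
    soDist n x y k SOState.Bwins SOState.Awins = 0 := by
  induction k with
  | zero => simp [soDist]
  | succ k ih => simpa [soDist] using ih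

lemma monotone_soDist_Awins (hx0 : 0 ≤ x) (hx1 : x ≤ 1) (hy0 : 0 ≤ y) (hy1 : y ≤ 1)
    (s : SOState n) : Monotone fun k => soDist n x y k s SOState.Awins := by
  refine monotone_nat_of_le_succ fun k => ?_
  have hx1' : 0 ≤ 1 - x := by linarith
  have hy1' : 0 ≤ 1 - y := by linarith
  induction k generalizing s with
  | zero =>
    by_cases hs : s = SOState.Awins
    · subst hs; simp only [soDist_Awins_Awins]; rfl
    · simpa [soDist, Ne.symm hs] using (soDist_mem_Icc hx0 hx1 hy0 hy1 1 s SOState.Awins).1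
  | succ k ih =>
    rcases s with ⟨i, j, _ | _ | _ | _⟩ | _ | _
    · rw [soDist, soDist]; gcongr <;> exact ih _
    · rw [soDist, soDist]; gcongr <;> exact ih _
    · rw [soDist, soDist]; gcongr <;> exact ih _
    · rw [soDist, soDist]; gcongr <;> exact ih _
    · rw [soDist, soDist]; exact ih _
    · rw [soDist, soDist]; exact ih _

lemma tendsto_soDist_Awins (hx0 : 0 ≤ x) (hx1 : x ≤ 1) (hy0 : 0 ≤ y) (hy1 : y ≤ 1)
    (s : SOState n) :
    Filter.Tendsto (fun k => soDist n x y k s SOState.Awins) Filter.atTop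
      (nhds (soWinA n x y s)) :=
  tendsto_atTop_ciSup (monotone_soDist_Awins hx0 hx1 hy0 hy1 s)
    ⟨1, by rintro _ ⟨k, rfl⟩; exact (soDist_mem_Icc hx0 hx1 hy0 hy1 k s _).2⟩

lemma soWinA_Awins : soWinA n x y SOState.Awins = 1 := by
  simp [soWinA, soDist_Awins_Awins]

lemma soWinA_Bwins : soWinA n x y SOState.Bwins = 0 := by
  simp [soWinA, soDist_Bwins_Awins]

lemma soWinA_eq_of_soDist_succ (hx0 : 0 ≤ x) (hx1 : x ≤ 1) (hy0 : 0 ≤ y) (hy1 : y ≤ 1)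
    {s s₁ s₂ : SOState n} {c : ℝ}
    (h : ∀ k, soDist n x y (k + 1) s SOState.Awins =
      c * soDist n x y k s₁ SOState.Awins + (1 - c) * soDist n x y k s₂ SOState.Awins) :
    soWinA n x y s = c * soWinA n x y s₁ + (1 - c) * soWinA n x y s₂ := by
  have h₁ := (Filter.tendsto_add_atTop_iff_nat 1).2 (tendsto_soDist_Awins hx0 hx1 hy0 hy1 s)
  simp only [h] at h₁
  exact tendsto_nhds_unique h₁
    (((tendsto_soDist_Awins hx0 hx1 hy0 hy1 s₁).const_mul c).add
      ((tendsto_soDist_Awins hx0 hx1 hy0 hy1 s₂).const_mul (1 - c)))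

lemma soWinA_A1 (hx0 : 0 ≤ x) (hx1 : x ≤ 1) (hy0 : 0 ≤ y) (hy1 : y ≤ 1) (i j : ℕ) :
    soWinA n x y (SOState.game i j SOSrv.A1) =
      x * soWinA n x y (soScoreA n i j SOSrv.A1)
        + (1 - x) * soWinA n x y (SOState.game i j SOSrv.A2) :=
  soWinA_eq_of_soDist_succ hx0 hx1 hy0 hy1 fun k => by rw [soDist]

lemma soWinA_A2 (hx0 : 0 ≤ x) (hx1 : x ≤ 1) (hy0 : 0 ≤ y) (hy1 : y ≤ 1) (i j : ℕ) :
    soWinA n x y (SOState.game i j SOSrv.A2) =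
      x * soWinA n x y (soScoreA n i j SOSrv.A2)
        + (1 - x) * soWinA n x y (SOState.game i j SOSrv.B1) :=
  soWinA_eq_of_soDist_succ hx0 hx1 hy0 hy1 fun k => by rw [soDist]

lemma soWinA_B1 (hx0 : 0 ≤ x) (hx1 : x ≤ 1) (hy0 : 0 ≤ y) (hy1 : y ≤ 1) (i j : ℕ) :
    soWinA n x y (SOState.game i j SOSrv.B1) =
      y * soWinA n x y (soScoreB n i j SOSrv.B1)
        + (1 - y) * soWinA n x y (SOState.game i j SOSrv.B2) :=
  soWinA_eq_of_soDist_succ hx0 hx1 hy0 hy1 fun k => by rw [soDist]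

lemma soWinA_B2 (hx0 : 0 ≤ x) (hx1 : x ≤ 1) (hy0 : 0 ≤ y) (hy1 : y ≤ 1) (i j : ℕ) :
    soWinA n x y (SOState.game i j SOSrv.B2) =
      y * soWinA n x y (soScoreB n i j SOSrv.B2)
        + (1 - y) * soWinA n x y (SOState.game i j SOSrv.A1) :=
  soWinA_eq_of_soDist_succ hx0 hx1 hy0 hy1 fun k => by rw [soDist]

end WinProbability

section LegendreSums

/-- The polynomial `∑ k, (i choose k) (j choose k) (-t) ^ k`, summed up to `k = N`. -/
noncomputable def chooseSum (N i j : ℕ) (t : ℝ) : ℝ :=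
  ∑ k ∈ Finset.range (N + 1), (i.choose k * j.choose k : ℝ) * (-t) ^ k

lemma chooseSum_comm (N i j : ℕ) (t : ℝ) : chooseSum N i j t = chooseSum N j i t := by
  simp only [chooseSum, mul_comm (i.choose _ : ℝ)]

lemma chooseSum_zero_right (N i : ℕ) (t : ℝ) : chooseSum N i 0 t = 1 := by
  simp [chooseSum, Finset.sum_range_succ']

lemma chooseSum_succ_succ {N i : ℕ} (hi : i < N) (j : ℕ) (t : ℝ) :
    chooseSum N (i + 1) (j + 1) t =
      chooseSum N i (j + 1) t + chooseSum N (i + 1) j t - (1 + t) * chooseSum N i j t := by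
  have shift : ∑ k ∈ Finset.range N, (i.choose k * j.choose k : ℝ) * (-t) ^ (k + 1) =
      -t * chooseSum N i j t := by
    rw [chooseSum, Finset.sum_range_succ, Nat.choose_eq_zero_of_lt hi]
    simp only [Nat.cast_zero, zero_mul, add_zero, Finset.mul_sum]
    exact Finset.sum_congr rfl fun k _ => by ring
  have : chooseSum N (i + 1) (j + 1) t - chooseSum N i (j + 1) t - chooseSum N (i + 1) j t
      + chooseSum N i j t = -t * chooseSum N i j t := by
    rw [← shift]
    simp only [chooseSum, ← Finset.sum_sub_distrib, ← Finset.sum_add_distrib]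
    rw [Finset.sum_range_succ']
    simp only [Nat.choose_zero_right, Nat.cast_one, pow_zero, mul_one, sub_self, zero_sub,
      neg_add_cancel, add_zero]
    refine Finset.sum_congr rfl fun k _ => ?_
    simp only [Nat.choose_succ_succ', Nat.cast_add]
    ring
  linear_combination this

/-- The alternating sum `∑ k, (-t) ^ k (k + i - 1 choose k) (k + j - 1 choose k)` in closed form,
for `i, j ≤ N + 1`; it is `0` when `i = 0` or `j = 0`. -/
noncomputable def slotSum (N : ℕ) (t : ℝ) : ℕ → ℕ → ℝ
  | i + 1, j + 1 => chooseSum N i j t / (1 + t) ^ (i + j + 1)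
  | 0, _ => 0
  | _, 0 => 0

lemma slotSum_zero_left (N : ℕ) (t : ℝ) (j : ℕ) : slotSum N t 0 j = 0 := by
  cases j <;> rfl

lemma slotSum_zero_right (N : ℕ) (t : ℝ) (i : ℕ) : slotSum N t i 0 = 0 := by
  cases i <;> rfl

lemma slotSum_comm (N : ℕ) (t : ℝ) (i j : ℕ) : slotSum N t i j = slotSum N t j i := by
  cases i <;> cases j <;> simp [slotSum, chooseSum_comm N, add_comm]

lemma slotSum_one_one (N : ℕ) {t : ℝ} (ht : 1 + t ≠ 0) : (1 + t) * slotSum N t 1 1 = 1 := by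
  simp [slotSum, chooseSum_zero_right, ht]

lemma slotSum_succ_one (N : ℕ) {t : ℝ} (ht : 1 + t ≠ 0) (i : ℕ) :
    (1 + t) * slotSum N t (i + 2) 1 = slotSum N t (i + 1) 1 := by
  simp only [slotSum, chooseSum_zero_right]
  field_simp
  ring

lemma slotSum_succ_succ {N : ℕ} {t : ℝ} (ht : 1 + t ≠ 0) {i j : ℕ} (hi : i ≤ N)
    (hij : (i, j) ≠ (0, 0)) :
    (1 + t) * slotSum N t (i + 1) (j + 1) =
      slotSum N t i (j + 1) + slotSum N t (i + 1) j - slotSum N t i j := by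
  rcases i with _ | i <;> rcases j with _ | j
  · simp at hij
  · rw [slotSum_comm N t 0, slotSum_comm N t 0, slotSum_comm N t (0 + 1), slotSum_comm N t (0 + 1),
      slotSum_zero_right, slotSum_zero_right]
    simpa using slotSum_succ_one N ht j
  · rw [slotSum_zero_right, slotSum_zero_right]
    simpa using slotSum_succ_one N ht i
  · simp only [slotSum, chooseSum_succ_succ (Nat.lt_of_succ_le hi)]
    field_simp
    ring

end LegendreSums

section Telescoping

lemma sum_boundary_of_forall_cell {n : ℕ} {F G : ℕ → ℕ → ℝ} {c : ℝ}
    (h : ∀ i < n + 1, ∀ j < n + 1, F (i + 1) j + G i (j + 1) =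
      F i j + G i j + if (i, j) = (0, 0) then c else 0)
    (hF : ∀ j, F 0 j = 0) (hG : ∀ i, G i 0 = 0) :
    ∑ j ∈ Finset.range (n + 1), F (n + 1) j + ∑ i ∈ Finset.range (n + 1), G i (n + 1) = c := by
  have hF' : ∀ j, F (n + 1) j = ∑ i ∈ Finset.range (n + 1), (F (i + 1) j - F i j) := fun j => by
    rw [Finset.sum_range_sub (fun i => F i j), hF, sub_zero]
  have hG' : ∀ i, G i (n + 1) = ∑ j ∈ Finset.range (n + 1), (G i (j + 1) - G i j) := fun i => by
    rw [Finset.sum_range_sub (G i), hG, sub_zero]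
  simp only [hF', hG']
  rw [Finset.sum_comm, ← Finset.sum_add_distrib]
  simp only [← Finset.sum_add_distrib]
  have : ∀ i ∈ Finset.range (n + 1), ∑ j ∈ Finset.range (n + 1),
      (F (i + 1) j - F i j + (G i (j + 1) - G i j)) = if i = 0 then c else 0 := by
    intro i hi
    have : ∀ j ∈ Finset.range (n + 1), F (i + 1) j - F i j + (G i (j + 1) - G i j) =
        if j = 0 then (if i = 0 then c else 0) else 0 := by
      intro j hj
      have := h i (Finset.mem_range.1 hi) j (Finset.mem_range.1 hj)
      have e : (if (i, j) = (0, 0) then c else 0) =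
          if j = 0 then (if i = 0 then c else 0) else 0 := by
        simp only [Prod.mk.injEq]; split_ifs <;> simp_all
      linarith
    rw [Finset.sum_congr rfl this]
    simp
  rw [Finset.sum_congr rfl this]
  simp

end Telescoping

section ClosedForm

/-- Flow of the difference of the two starting positions through an `m + 1` by `m + 1` square of
scores on which the values `a₁ a₂ b₁ b₂` of the four servers satisfy the rally equations. -/
lemma sub_eq_of_rally_equations {m : ℕ} {x y : ℝ} {a₁ a₂ b₁ b₂ : ℕ → ℕ → ℝ} (hm : 1 ≤ m)
    (ht : 1 + (1 - x) * (1 - y) ≠ 0)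
    (h₁ : ∀ i ≤ m, ∀ j ≤ m, a₁ i j = x * a₁ (i + 1) j + (1 - x) * a₂ i j)
    (h₂ : ∀ i ≤ m, ∀ j ≤ m, a₂ i j = x * a₂ (i + 1) j + (1 - x) * b₁ i j)
    (h₃ : ∀ i ≤ m, ∀ j ≤ m, b₁ i j = y * b₁ i (j + 1) + (1 - y) * b₂ i j)
    (h₄ : ∀ i ≤ m, ∀ j ≤ m, b₂ i j = y * b₂ i (j + 1) + (1 - y) * a₁ i j)
    (hA : ∀ j < m, a₁ (m + 1) j = 1 ∧ a₂ (m + 1) j = 1)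
    (hB : ∀ i < m, b₁ i (m + 1) = 0 ∧ b₂ i (m + 1) = 0) :
    a₂ 0 0 - b₂ 0 0 =
      (x * y) ^ m * (slotSum m ((1 - x) * (1 - y)) m (m + 1) *
          (x + (a₂ m m - b₂ m m) + (1 - x) * b₁ m m - (1 - y) * a₁ m m)
        - slotSum m ((1 - x) * (1 - y)) m m * (a₂ m m - b₂ m m)) := by
  set t := (1 - x) * (1 - y) with ht_def
  set S := slotSum m t
  let F : ℕ → ℕ → ℝ := fun i j =>
    x ^ i * y ^ j * ((S i (j + 1) - S i j) * a₂ i j - (1 - y) * S i (j + 1) * a₁ i j)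
  let G : ℕ → ℕ → ℝ := fun i j =>
    x ^ i * y ^ j * ((1 - x) * S (i + 1) j * b₁ i j - (S (i + 1) j - S i j) * b₂ i j)
  have cell : ∀ i < m + 1, ∀ j < m + 1, F (i + 1) j + G i (j + 1) =
      F i j + G i j + if (i, j) = (0, 0) then a₂ 0 0 - b₂ 0 0 else 0 := by
    intro i hi j hj
    have e₁ := h₁ i (by omega) j (by omega)
    have e₂ := h₂ i (by omega) j (by omega)
    have e₃ := h₃ i (by omega) j (by omega)
    have e₄ := h₄ i (by omega) j (by omega)
    by_cases hij : (i, j) = (0, 0)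
    · obtain ⟨rfl, rfl⟩ := Prod.mk.inj hij
      have hS : (1 + t) * S 1 1 = 1 := slotSum_one_one m ht
      have z₁ : ∀ j, S 0 j = 0 := slotSum_zero_left m t
      have z₂ : ∀ i, S i 0 = 0 := slotSum_zero_right m t
      simp only [F, G, zero_add, z₁, z₂, if_true]
      linear_combination (a₂ 0 0 - b₂ 0 0) * hS + S 1 1 * ((1 - y) * e₁ - e₂ - (1 - x) * e₃ + e₄)
        - S 1 1 * (a₂ 0 0 - b₂ 0 0) * ht_def
    · have hS : (1 + t) * S (i + 1) (j + 1) = S i (j + 1) + S (i + 1) j - S i j :=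
        slotSum_succ_succ ht (by omega) hij
      simp only [F, G, if_neg hij]
      linear_combination x ^ i * y ^ j * ((a₂ i j - b₂ i j) * hS
        + S (i + 1) (j + 1) * ((1 - y) * e₁ - e₂ - (1 - x) * e₃ + e₄)
        + S (i + 1) j * e₂ - S i (j + 1) * e₄)
  have total := sum_boundary_of_forall_cell cell
    (fun j => by simp [F, S, slotSum_zero_left]) (fun i => by simp [G, S, slotSum_zero_right])
  have hF : ∑ j ∈ Finset.range m, F (m + 1) j = x ^ (m + 1) * y ^ m * S (m + 1) m := by
    have : ∀ j ∈ Finset.range m, F (m + 1) j =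
        x ^ (m + 1) * y ^ (j + 1) * S (m + 1) (j + 1) - x ^ (m + 1) * y ^ j * S (m + 1) j := by
      intro j hj
      obtain ⟨e₁, e₂⟩ := hA j (Finset.mem_range.1 hj)
      simp only [F, e₁, e₂]
      ring
    rw [Finset.sum_congr rfl this,
      Finset.sum_range_sub (fun j => x ^ (m + 1) * y ^ j * S (m + 1) j)]
    simp [S, slotSum_zero_right]
  have hG : ∑ i ∈ Finset.range m, G i (m + 1) = 0 :=
    Finset.sum_eq_zero fun i hi => by
      obtain ⟨e₁, e₂⟩ := hB i (Finset.mem_range.1 hi)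
      simp [G, e₁, e₂]
  have corner := cell m (by omega) m (by omega)
  rw [if_neg (by simp; omega), add_zero] at corner
  rw [Finset.sum_range_succ, Finset.sum_range_succ, hF, hG] at total
  have hS : S (m + 1) m = S m (m + 1) := slotSum_comm m t _ _
  simp only [F, G] at corner total
  rw [hS] at corner total
  linear_combination -total + corner

/-- Values `A₁ A₂ B₁ B₂` at deuce, `X₁ … X₄` at Team A's advantage and `Y₁ … Y₄` at
Team B's advantage. -/
lemma deuce_values {x y p t A₁ A₂ B₁ B₂ X₁ X₂ X₃ X₄ Y₁ Y₂ Y₃ Y₄ : ℝ}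
    (hp : p = x * y) (ht : t = (1 - x) * (1 - y)) (ht1 : t ≠ 1) (ht1' : 1 + t ≠ 0)
    (hA₁ : A₁ = x * X₁ + (1 - x) * A₂) (hA₂ : A₂ = x * X₂ + (1 - x) * B₁)
    (hB₁ : B₁ = y * Y₁ + (1 - y) * B₂) (hB₂ : B₂ = y * Y₂ + (1 - y) * A₁)
    (hX₁ : X₁ = x * 1 + (1 - x) * X₂) (hX₂ : X₂ = x * 1 + (1 - x) * X₃)
    (hX₃ : X₃ = y * B₁ + (1 - y) * X₄) (hX₄ : X₄ = y * B₂ + (1 - y) * X₁)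
    (hY₁ : Y₁ = y * 0 + (1 - y) * Y₂) (hY₂ : Y₂ = y * 0 + (1 - y) * Y₃)
    (hY₃ : Y₃ = x * A₁ + (1 - x) * Y₄) (hY₄ : Y₄ = x * A₂ + (1 - x) * Y₁) :
    ((1 - t) * (1 + t) ^ 2 + p * t * (3 - t)) * (A₂ - B₂) = p ^ 2 ∧
    ((1 - t) * (1 + t) ^ 2 + p * t * (3 - t)) *
      (x + (A₂ - B₂) + (1 - x) * B₁ - (1 - y) * A₁) = p * (1 + t) * (1 + t + p) := by
  obtain ⟨u, hu⟩ : ∃ u, u = 1 - x := ⟨_, rfl⟩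
  obtain ⟨v, hv⟩ : ∃ v, v = 1 - y := ⟨_, rfl⟩
  obtain rfl : x = 1 - u := by linarith
  obtain rfl : y = 1 - v := by linarith
  simp only [sub_sub_cancel] at *
  subst hp ht
  set k := 1 - u ^ 2 * v ^ 2 with hk
  have hk0 : k ≠ 0 := by
    have : k = (1 - u * v) * (1 + u * v) := by rw [hk]; ring
    rw [this]
    exact mul_ne_zero (sub_ne_zero.2 (Ne.symm ht1)) ht1'
  obtain ⟨α, hα⟩ : ∃ α, α = A₁ + u * A₂ := ⟨_, rfl⟩
  obtain ⟨β, hβ⟩ : ∃ β, β = (1 + v) - (B₁ + v * B₂) := ⟨_, rfl⟩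
  have kX₂ : k * X₂ = k - u * (1 - v) * β := by
    rw [hk, hβ]; linear_combination hX₂ + u * hX₃ + u * v * hX₄ + u * v ^ 2 * hX₁
  have kX₁ : k * X₁ = k - u ^ 2 * (1 - v) * β := by
    linear_combination k * hX₁ + u * kX₂
  have kY₂ : k * Y₂ = v * (1 - u) * α := by
    rw [hk, hα]; linear_combination hY₂ + v * hY₃ + v * u * hY₄ + v * u ^ 2 * hY₁
  have kY₁ : k * Y₁ = v ^ 2 * (1 - u) * α := by
    linear_combination k * hY₁ + v * kY₂
  have kA₁ : k * A₁ = (1 - u) * X₁ + u * (1 - u) * X₂ + u ^ 2 * (1 - v) * Y₁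
      + u ^ 2 * v * (1 - v) * Y₂ := by
    rw [hk]; linear_combination hA₁ + u * hA₂ + u ^ 2 * hB₁ + u ^ 2 * v * hB₂
  have kA₂ : k * A₂ = (1 - u) * X₂ + u * (1 - v) * Y₁ + u * v * (1 - v) * Y₂
      + u * v ^ 2 * (1 - u) * X₁ := by
    rw [hk]; linear_combination hA₂ + u * hB₁ + u * v * hB₂ + u * v ^ 2 * hA₁
  have kB₁ : k * B₁ = (1 - v) * Y₁ + v * (1 - v) * Y₂ + v ^ 2 * (1 - u) * X₁
      + v ^ 2 * u * (1 - u) * X₂ := by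
    rw [hk]; linear_combination hB₁ + v * hB₂ + v ^ 2 * hA₁ + v ^ 2 * u * hA₂
  have kB₂ : k * B₂ = (1 - v) * Y₂ + v * (1 - u) * X₁ + v * u * (1 - u) * X₂
      + v * u ^ 2 * (1 - v) * Y₁ := by
    rw [hk]; linear_combination hB₂ + v * hA₁ + v * u * hA₂ + v * u ^ 2 * hB₁
  obtain ⟨M, hM⟩ : ∃ M, M = (1 - u * v) * (1 + u * v) ^ 2
      + (1 - u) * (1 - v) * (u * v) * (3 - u * v) := ⟨_, rfl⟩
  rw [← hM]
  have mix : M * (v * α + u * β) =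
      k * ((1 + u * v) ^ 2 - (1 - u) * (1 - v) * (1 - u * v)) := by
    refine mul_left_cancel₀ (sub_ne_zero.2 (Ne.symm ht1)) ?_
    have kα : k * (k * α) = (1 - u) * (k * X₁) + u * (1 - u) * (k * X₂)
        + u ^ 2 * (1 - v) * (k * Y₁) + u ^ 2 * v * (1 - v) * (k * Y₂)
        + u * ((1 - u) * (k * X₂) + u * (1 - v) * (k * Y₁) + u * v * (1 - v) * (k * Y₂)
          + u * v ^ 2 * (1 - u) * (k * X₁)) := by
      rw [hα]; linear_combination k * kA₁ + k * u * kA₂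
    have kβ : k * (k * β) = k ^ 2 * (1 + v) - ((1 - v) * (k * Y₁) + v * (1 - v) * (k * Y₂)
        + v ^ 2 * (1 - u) * (k * X₁) + v ^ 2 * u * (1 - u) * (k * X₂)
        + v * ((1 - v) * (k * Y₂) + v * (1 - u) * (k * X₁) + v * u * (1 - u) * (k * X₂)
          + v * u ^ 2 * (1 - v) * (k * Y₁))) := by
      rw [hβ]; linear_combination -k * kB₁ - k * v * kB₂
    rw [kX₁, kX₂, kY₁, kY₂] at kα kβ
    rw [hk] at kα kβ ⊢
    rw [hM]
    linear_combination v * kα + u * kβ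
  have k2h : k ^ 2 * (A₂ - B₂) =
      (1 - u) * (1 - v) * (1 - u * v) * (k - (1 - u * v) * (v * α + u * β)) := by
    have : k ^ 2 * (A₂ - B₂) = (1 - u) * (k * X₂) + u * (1 - v) * (k * Y₁)
        + u * v * (1 - v) * (k * Y₂) + u * v ^ 2 * (1 - u) * (k * X₁)
        - ((1 - v) * (k * Y₂) + v * (1 - u) * (k * X₁) + v * u * (1 - u) * (k * X₂)
          + v * u ^ 2 * (1 - v) * (k * Y₁)) := by
      linear_combination k * kA₂ - k * kB₂
    rw [this, kX₁, kX₂, kY₁, kY₂, hk]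
    ring
  have hh : M * (A₂ - B₂) = ((1 - u) * (1 - v)) ^ 2 := by
    refine mul_left_cancel₀ (pow_ne_zero 2 hk0) ?_
    have : k ^ 2 * (M * (A₂ - B₂)) = (1 - u) * (1 - v) * (1 - u * v) *
        (k * M - (1 - u * v) * (M * (v * α + u * β))) := by linear_combination M * k2h
    rw [this, mix, hM, hk]
    ring
  refine ⟨hh, mul_left_cancel₀ hk0 ?_⟩
  have : k * (M * (1 - u + (A₂ - B₂) + u * B₁ - v * A₁)) =
      2 * k * (M * (A₂ - B₂)) + (1 - u) * (1 - v) * (M * (v * α + u * β)) := by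
    linear_combination M * (-k * hA₂ + k * hB₂ - (1 - u) * kX₂ + (1 - v) * kY₂)
  rw [this, hh, mix]
  ring

/-- Closed form of the first-serving team's advantage in terms of `x * y` and
`(1 - x) * (1 - y)`. -/
lemma soAdv_eq {m : ℕ} {x y : ℝ} (hm : 1 ≤ m) (hx0 : 0 ≤ x) (hx1 : x ≤ 1) (hy0 : 0 ≤ y)
    (hy1 : y ≤ 1) {p t : ℝ} (hp : p = x * y) (ht : t = (1 - x) * (1 - y)) (ht1 : t < 1) :
    soAdv (m + 1) x y = p ^ (m + 1) *
      ((1 + t) * (1 + t + p) * slotSum m t m (m + 1) - p * slotSum m t m m) /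
        ((1 - t) * (1 + t) ^ 2 + p * t * (3 - t)) := by
  have hp0 : 0 ≤ p := hp ▸ mul_nonneg hx0 hy0
  have ht0 : 0 ≤ t := ht ▸ mul_nonneg (by linarith) (by linarith)
  have eA₁ := soWinA_A1 (n := m + 1) hx0 hx1 hy0 hy1
  have eA₂ := soWinA_A2 (n := m + 1) hx0 hx1 hy0 hy1
  have eB₁ := soWinA_B1 (n := m + 1) hx0 hx1 hy0 hy1
  have eB₂ := soWinA_B2 (n := m + 1) hx0 hx1 hy0 hy1
  have scoreA : ∀ i ≤ m, ∀ j ≤ m, ∀ s, soWinA (m + 1) x y (soScoreA (m + 1) i j s) =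
      if i = m ∧ j < m then 1 else soWinA (m + 1) x y (.game (i + 1) j s) := by
    intro i hi j hj s
    rcases hi.lt_or_eq with hi' | rfl
    · simp [soScoreA, hi'.ne, show i ≠ m + 1 by omega]
    · rcases hj.lt_or_eq with hj' | rfl
      · simp [soScoreA, hj', hj'.ne, show j ≠ i + 1 by omega, soWinA_Awins]
      · simp [soScoreA]
  have scoreB : ∀ i ≤ m, ∀ j ≤ m, ∀ s, soWinA (m + 1) x y (soScoreB (m + 1) i j s) =
      if j = m ∧ i < m then 0 else soWinA (m + 1) x y (.game i (j + 1) s) := by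
    intro i hi j hj s
    rcases hj.lt_or_eq with hj' | rfl
    · simp [soScoreB, hj'.ne, show j ≠ m + 1 by omega]
    · rcases hi.lt_or_eq with hi' | rfl
      · simp [soScoreB, hi', hi'.ne, show i ≠ j + 1 by omega, soWinA_Bwins]
      · simp [soScoreB]
  let a : SOSrv → ℕ → ℕ → ℝ := fun s i j =>
    if i = m + 1 ∧ j < m then 1 else soWinA (m + 1) x y (.game i j s)
  let b : SOSrv → ℕ → ℕ → ℝ := fun s i j =>
    if j = m + 1 ∧ i < m then 0 else soWinA (m + 1) x y (.game i j s)
  have a_of_le : ∀ s, ∀ i ≤ m, ∀ j, a s i j = soWinA (m + 1) x y (.game i j s) := fun s i hi j =>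
    if_neg (by omega)
  have b_of_le : ∀ s i, ∀ j ≤ m, b s i j = soWinA (m + 1) x y (.game i j s) := fun s i j hj =>
    if_neg (by omega)
  have a_succ : ∀ s, ∀ i ≤ m, ∀ j ≤ m, a s (i + 1) j =
      soWinA (m + 1) x y (soScoreA (m + 1) i j s) := by
    intro s i hi j hj
    rw [scoreA i hi j hj]
    simp [a]
  have b_succ : ∀ s, ∀ i ≤ m, ∀ j ≤ m, b s i (j + 1) =
      soWinA (m + 1) x y (soScoreB (m + 1) i j s) := by
    intro s i hi j hj
    rw [scoreB i hi j hj]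
    simp [b]
  have flow := sub_eq_of_rally_equations (x := x) (y := y) (a₁ := a .A1) (a₂ := a .A2)
    (b₁ := b .B1) (b₂ := b .B2) hm (by rw [← ht]; positivity)
    (fun i hi j hj => by rw [a_succ _ i hi j hj, a_of_le _ i hi, a_of_le _ i hi]; exact eA₁ i j)
    (fun i hi j hj => by rw [a_succ _ i hi j hj, a_of_le _ i hi, b_of_le _ i j hj]; exact eA₂ i j)
    (fun i hi j hj => by rw [b_succ _ i hi j hj, b_of_le _ i j hj, b_of_le _ i j hj]; exact eB₁ i j)
    (fun i hi j hj => by rw [b_succ _ i hi j hj, b_of_le _ i j hj, a_of_le _ i hi]; exact eB₂ i j)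
    (fun j hj => by simp [a, hj]) (fun i hi => by simp [b, hi])
  simp only [a_of_le _ _ (Nat.zero_le m), b_of_le _ _ _ (Nat.zero_le m), a_of_le _ _ (le_refl m),
    b_of_le _ _ _ (le_refl m)] at flow
  have dA : ∀ s, soScoreA (m + 1) m m s = .game (m + 1) m s := fun s => by simp [soScoreA]
  have dB : ∀ s, soScoreB (m + 1) m m s = .game m (m + 1) s := fun s => by simp [soScoreB]
  have advAA : ∀ s, soScoreA (m + 1) (m + 1) m s = .Awins := fun s => by simp [soScoreA]
  have advAB : ∀ s, soScoreB (m + 1) (m + 1) m s = .game m m s := fun s => by simp [soScoreB]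
  have advBB : ∀ s, soScoreB (m + 1) m (m + 1) s = .Bwins := fun s => by simp [soScoreB]
  have advBA : ∀ s, soScoreA (m + 1) m (m + 1) s = .game m m s := fun s => by simp [soScoreA]
  have vA₁ := eA₁ m m
  have vA₂ := eA₂ m m
  have vB₁ := eB₁ m m
  have vB₂ := eB₂ m m
  have xA₁ := eA₁ (m + 1) m
  have xA₂ := eA₂ (m + 1) m
  have xB₁ := eB₁ (m + 1) m
  have xB₂ := eB₂ (m + 1) m
  have yB₁ := eB₁ m (m + 1)
  have yB₂ := eB₂ m (m + 1)
  have yA₁ := eA₁ m (m + 1)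
  have yA₂ := eA₂ m (m + 1)
  rw [dA] at vA₁ vA₂
  rw [dB] at vB₁ vB₂
  rw [advAA, soWinA_Awins] at xA₁ xA₂
  rw [advAB] at xB₁ xB₂
  rw [advBB, soWinA_Bwins] at yB₁ yB₂
  rw [advBA] at yA₁ yA₂
  obtain ⟨hh, hg⟩ := deuce_values hp ht ht1.ne (by positivity) vA₁ vA₂ vB₁ vB₂ xA₁ xA₂ xB₁ xB₂
    yB₁ yB₂ yA₁ yA₂
  rw [← hp, ← ht] at flow
  rw [soAdv, flow, eq_div_iff]
  · linear_combination p ^ m * (slotSum m t m (m + 1) * hg - slotSum m t m m * hh)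
  · have : 0 < (1 - t) * (1 + t) ^ 2 := mul_pos (by linarith) (by positivity)
    have : 0 ≤ p * t * (3 - t) := mul_nonneg (mul_nonneg hp0 ht0) (by linarith)
    linarith

end ClosedForm

section PolynomialPositivity

/-- The value at `z` of the polynomial with coefficient list `L`, constant term first. -/
noncomputable def polyEval : List ℤ → ℝ → ℝ
  | [], _ => 0
  | c :: L, z => c + z * polyEval L z

/-- Coefficient list of the sum of two polynomials. -/
def polyAdd : List ℤ → List ℤ → List ℤ
  | [], L => L
  | c :: K, [] => c :: K
  | c :: K, d :: L => (c + d) :: polyAdd K L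

/-- Coefficient list of a constant multiple of a polynomial. -/
def polySMul (c : ℤ) : List ℤ → List ℤ
  | [] => []
  | d :: L => (c * d) :: polySMul c L

/-- Coefficient list of the product of two polynomials. -/
def polyMul : List ℤ → List ℤ → List ℤ
  | [], _ => []
  | c :: K, L => polyAdd (polySMul c L) (0 :: polyMul K L)

/-- Coefficient list of a power of a polynomial. -/
def polyPow (L : List ℤ) : ℕ → List ℤ
  | 0 => [1]
  | k + 1 => polyMul L (polyPow L k)

lemma polyEval_polyAdd (K L : List ℤ) (z : ℝ) :
    polyEval (polyAdd K L) z = polyEval K z + polyEval L z := by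
  induction K generalizing L with
  | nil => simp [polyAdd, polyEval]
  | cons c K ih =>
    cases L with
    | nil => simp [polyAdd, polyEval]
    | cons d L => simp only [polyAdd, polyEval, ih]; push_cast; ring

lemma polyEval_polySMul (c : ℤ) (L : List ℤ) (z : ℝ) :
    polyEval (polySMul c L) z = c * polyEval L z := by
  induction L with
  | nil => simp [polySMul, polyEval]
  | cons d L ih => simp only [polySMul, polyEval, ih]; push_cast; ring

lemma polyEval_polyMul (K L : List ℤ) (z : ℝ) :
    polyEval (polyMul K L) z = polyEval K z * polyEval L z := by
  induction K with
  | nil => simp [polyMul, polyEval]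
  | cons c K ih =>
    simp only [polyMul, polyEval_polyAdd, polyEval_polySMul, polyEval, ih]; push_cast; ring

lemma polyEval_polyPow (L : List ℤ) (k : ℕ) (z : ℝ) :
    polyEval (polyPow L k) z = polyEval L z ^ k := by
  induction k with
  | zero => simp [polyPow, polyEval]
  | succ k ih => rw [polyPow, polyEval_polyMul, ih, pow_succ']

/-- A lower bound on `[0, 1]` for the polynomial with coefficient list `L`. -/
def polyLowerBound : List ℤ → ℤ
  | [] => 0
  | c :: L => c + min 0 (polyLowerBound L)

lemma polyLowerBound_le (L : List ℤ) {z : ℝ} (h0 : 0 ≤ z) (h1 : z ≤ 1) :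
    (polyLowerBound L : ℝ) ≤ polyEval L z := by
  induction L with
  | nil => simp [polyLowerBound, polyEval]
  | cons c L ih =>
    simp only [polyLowerBound, polyEval]
    push_cast
    gcongr
    rcases le_total (0 : ℝ) (polyLowerBound L) with h | h
    · rw [min_eq_left h]; exact mul_nonneg h0 (h.trans ih)
    · rw [min_eq_right h]; nlinarith

/-- Coefficient list of the polynomial `d ^ L.length * L ((a + w * z) / d)` in `z`. -/
def polyRescale (d a w : ℤ) : List ℤ → List ℤ
  | [] => []
  | c :: L => polyAdd [c * d ^ (L.length + 1)] (polyMul [a, w] (polyRescale d a w L))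

lemma polyEval_polyRescale {d : ℤ} (hd : (d : ℝ) ≠ 0) (a w : ℤ) (L : List ℤ) (z : ℝ) :
    polyEval (polyRescale d a w L) z = d ^ L.length * polyEval L ((a + w * z) / d) := by
  induction L with
  | nil => simp [polyRescale, polyEval]
  | cons c L ih =>
    simp only [polyRescale, polyEval_polyAdd, polyEval_polyMul, polyEval, ih, List.length_cons]
    push_cast
    field_simp
    ring

/-- A test for nonnegativity of the polynomial `L` on the consecutive intervals
`[a / d, (a + w₁) / d]`, `[(a + w₁) / d, (a + w₁ + w₂) / d]`, … -/
def polyNonnegTest (d : ℤ) (L : List ℤ) : ℤ → List ℤ → Bool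
  | _, [] => true
  | a, w :: ws =>
    decide (0 < w) && decide (0 ≤ polyLowerBound (polyRescale d a w L)) &&
      polyNonnegTest d L (a + w) ws

lemma polyEval_nonneg_of_test {d : ℤ} (hd : 0 < d) {L : List ℤ} {a : ℤ} {ws : List ℤ}
    (h : polyNonnegTest d L a ws = true) {r : ℝ} (h0 : (a : ℝ) / d ≤ r)
    (h1 : r < ((a + ws.sum : ℤ) : ℝ) / d) : 0 ≤ polyEval L r := by
  have hd' : (0 : ℝ) < d := by exact_mod_cast hd
  induction ws generalizing a with
  | nil => simp at h1; linarith
  | cons w ws ih =>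
    simp only [polyNonnegTest, Bool.and_eq_true, decide_eq_true_eq] at h
    obtain ⟨⟨hw, hlb⟩, hrest⟩ := h
    rcases le_total (((a + w : ℤ) : ℝ) / d) r with hr | hr
    · exact ih hrest hr (by rwa [List.sum_cons, ← add_assoc] at h1)
    · have hw' : (0 : ℝ) < w := by exact_mod_cast hw
      rw [div_le_iff₀ hd'] at h0
      rw [le_div_iff₀ hd'] at hr
      push_cast at hr
      have key := polyEval_polyRescale hd'.ne' a w L ((r * d - a) / w)
      have hr' : ((a : ℝ) + w * ((r * d - a) / w)) / d = r := by field_simp; ring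
      rw [hr'] at key
      have hz : (0 : ℝ) ≤ polyEval (polyRescale d a w L) ((r * d - a) / w) :=
        le_trans (by exact_mod_cast hlb) (polyLowerBound_le _ (div_nonneg (by linarith) hw'.le)
          (by rw [div_le_one hw']; linarith))
      rw [key] at hz
      exact nonneg_of_mul_nonneg_right hz (by positivity)

end PolynomialPositivity

section ClosedFormNumerator

/-- Coefficient list of `(1 + t) * chooseSum 10 9 10 t`. -/
def advConst : List ℤ := [1, -89, 1530, -8460, 16380, -5292, -14112, 13320, -3915, 395, -10]

/-- Coefficient list of `chooseSum 10 9 10 t - chooseSum 10 9 9 t`. -/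
def advSlope : List ℤ := [0, -9, 324, -3024, 10584, -15876, 10584, -3024, 324, -9]

/-- Coefficient list of the polynomial obtained from `L` by squaring the variable. -/
def polyEven : List ℤ → List ℤ
  | [] => []
  | c :: L => c :: 0 :: polyEven L

lemma polyEval_polyEven (L : List ℤ) (z : ℝ) : polyEval (polyEven L) z = polyEval L (z ^ 2) := by
  induction L with
  | nil => simp [polyEven, polyEval]
  | cons c L ih => simp only [polyEven, polyEval, ih]; push_cast; ring

/-- Coefficient list, in `r = √t`, of `10 ^ 9` times the numerator of `f_11 + 8 / 10 ^ 9` on the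
curve `√p = 1 - √t`, where `x = y`. -/
def extremeCurvePoly : List ℤ :=
  polyAdd
    (polySMul (10 ^ 9) (polyMul (polyPow [1, -1] 22)
      (polyAdd (polyEven advConst) (polyMul (polyPow [1, -1] 2) (polyEven advSlope)))))
    (polySMul 8 (polyMul (polyPow [1, 0, 1] 19)
      (polyAdd [1, 0, 1, 0, -1, 0, -1] (polyMul (polyPow [1, -1] 2) [0, 0, 3, 0, -1]))))

lemma extremeCurvePoly_nonneg {r : ℝ} (h0 : 0.447 ≤ r) (h1 : r < 0.592) :
    0 ≤ polyEval extremeCurvePoly r :=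
  polyEval_nonneg_of_test (d := 1000) (a := 447) (ws := [11, 7, 5, 3, 2, 2, 58, 57]) (by norm_num)
    (by decide +kernel) (by norm_num at h0 ⊢; exact h0) (by norm_num at h1 ⊢; exact h1)

lemma polyEval_extremeCurvePoly (r : ℝ) :
    polyEval extremeCurvePoly r =
      10 ^ 9 * ((1 - r) ^ 22 *
        (polyEval advConst (r ^ 2) + (1 - r) ^ 2 * polyEval advSlope (r ^ 2))) +
      8 * ((1 + r ^ 2) ^ 19 *
        ((1 - r ^ 2) * (1 + r ^ 2) ^ 2 + (1 - r) ^ 2 * r ^ 2 * (3 - r ^ 2))) := by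
  have h1 : polyEval [1, -1] r = 1 - r := by simp [polyEval]; ring
  have h2 : polyEval [1, 0, 1] r = 1 + r ^ 2 := by simp [polyEval]; ring
  have h3 : polyEval [1, 0, 1, 0, -1, 0, -1] r = (1 - r ^ 2) * (1 + r ^ 2) ^ 2 := by
    simp [polyEval]; ring
  have h4 : polyEval [0, 0, 3, 0, -1] r = r ^ 2 * (3 - r ^ 2) := by simp [polyEval]; ring
  simp only [extremeCurvePoly, polyEval_polyAdd, polyEval_polySMul, polyEval_polyMul,
    polyEval_polyPow, polyEval_polyEven, h1, h2, h3, h4]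
  push_cast
  ring

lemma advConst_nonneg {t : ℝ} (h0 : 0.12 ≤ t) (h1 : t < 0.2) : 0 ≤ polyEval advConst t :=
  polyEval_nonneg_of_test (d := 100) (a := 12) (ws := [8]) (by norm_num)
    (by decide +kernel) (by norm_num at h0 ⊢; exact h0) (by norm_num at h1 ⊢; exact h1)

lemma two_mul_advConst_add_advSlope_nonneg {t : ℝ} (h0 : 0.12 ≤ t) (h1 : t < 0.2) :
    0 ≤ 2 * polyEval advConst t + polyEval advSlope t := by
  have := polyEval_nonneg_of_test (d := 100) (L := polyAdd (polySMul 2 advConst) advSlope) (a := 12)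
    (ws := [7, 1]) (r := t) (by norm_num) (by decide +kernel) (by norm_num at h0 ⊢; exact h0)
    (by norm_num at h1 ⊢; exact h1)
  simpa [polyEval_polyAdd, polyEval_polySMul] using this

lemma advSlope_nonpos {t : ℝ} (h0 : 0.2 ≤ t) (h1 : t < 0.35) : polyEval advSlope t ≤ 0 := by
  have := polyEval_nonneg_of_test (d := 1000) (L := polySMul (-1) advSlope) (a := 200)
    (ws := [142, 8]) (r := t) (by norm_num) (by decide +kernel) (by norm_num at h0 ⊢; exact h0)
    (by norm_num at h1 ⊢; exact h1)
  simpa [polyEval_polySMul] using this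

lemma neg_six_le_advConst {t : ℝ} (h0 : 0.35 ≤ t) (h1 : t < 0.57) : -6 ≤ polyEval advConst t := by
  have := polyEval_nonneg_of_test (d := 100) (L := polyAdd advConst [6]) (a := 35)
    (ws := [4, 18]) (r := t) (by norm_num) (by decide +kernel) (by norm_num at h0 ⊢; exact h0)
    (by norm_num at h1 ⊢; exact h1)
  rw [polyEval_polyAdd] at this
  norm_num [polyEval] at this ⊢
  linarith

lemma neg_one_le_advSlope {t : ℝ} (h0 : 0.35 ≤ t) (h1 : t < 0.57) : -1 ≤ polyEval advSlope t := by
  have := polyEval_nonneg_of_test (d := 100) (L := polyAdd advSlope [1]) (a := 35)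
    (ws := [22]) (r := t) (by norm_num) (by decide +kernel) (by norm_num at h0 ⊢; exact h0)
    (by norm_num at h1 ⊢; exact h1)
  rw [polyEval_polyAdd] at this
  norm_num [polyEval] at this ⊢
  linarith

end ClosedFormNumerator

section LowerBound

lemma soAdv_eleven_eq {x y : ℝ} (hx0 : 0 ≤ x) (hx1 : x ≤ 1) (hy0 : 0 ≤ y) (hy1 : y ≤ 1) {p t : ℝ}
    (hp : p = x * y) (ht : t = (1 - x) * (1 - y)) (ht1 : t < 1) :
    soAdv 11 x y = p ^ 11 * (polyEval advConst t + p * polyEval advSlope t) /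
      ((1 + t) ^ 19 * ((1 - t) * (1 + t) ^ 2 + p * t * (3 - t))) := by
  have ht0 : 0 ≤ t := by rw [ht]; exact mul_nonneg (by linarith) (by linarith)
  have hA : polyEval advConst t = (1 + t) * chooseSum 10 9 10 t := by
    simp [polyEval, advConst, chooseSum, Finset.sum_range_succ, Nat.choose]; ring
  have hB : polyEval advSlope t = chooseSum 10 9 10 t - chooseSum 10 9 9 t := by
    simp [polyEval, advSlope, chooseSum, Finset.sum_range_succ, Nat.choose]; ring
  have h1 : slotSum 10 t 10 (10 + 1) = chooseSum 10 9 10 t / (1 + t) ^ 20 := rfl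
  have h2 : slotSum 10 t 10 10 = chooseSum 10 9 9 t / (1 + t) ^ 19 := rfl
  have hpos : 1 + t ≠ 0 := by positivity
  rw [show 11 = 10 + 1 from rfl, soAdv_eq (by norm_num) hx0 hx1 hy0 hy1 hp ht ht1, h1, h2, hA, hB,
    ← div_div]
  congr 1
  field_simp
  ring

lemma cleared_nonneg_of_small {p t : ℝ} (hp0 : 0 ≤ p) (hp1 : p ≤ 1 / 2) (h0 : 0.12 ≤ t)
    (h1 : t < 0.2) : 0 ≤ polyEval advConst t + p * polyEval advSlope t := by
  have hA := advConst_nonneg h0 h1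
  have hB := two_mul_advConst_add_advSlope_nonneg h0 h1
  nlinarith [mul_nonneg (by linarith : 0 ≤ 1 - 2 * p) hA, mul_nonneg hp0 hB]

lemma cleared_nonneg_of_medium {p r : ℝ} (hp0 : 0 ≤ p) (hr0 : 0.447 ≤ r) (hr1 : r < 0.592)
    (h0 : 0.2 ≤ r ^ 2) (h1 : r ^ 2 < 0.35) (hpr : p ≤ (1 - r) ^ 2) :
    0 ≤ 10 ^ 9 * (p ^ 11 * (polyEval advConst (r ^ 2) + p * polyEval advSlope (r ^ 2))) +
      8 * ((1 + r ^ 2) ^ 19 *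
        ((1 - r ^ 2) * (1 + r ^ 2) ^ 2 + p * r ^ 2 * (3 - r ^ 2))) := by
  have hcurve := extremeCurvePoly_nonneg hr0 hr1
  rw [polyEval_extremeCurvePoly, show (1 - r) ^ 22 = ((1 - r) ^ 2) ^ 11 by ring] at hcurve
  have hB := advSlope_nonpos h0 h1
  have hP : 0 < (1 - r) ^ 2 := by
    have : 0 < 1 - r := by linarith
    positivity
  set t := r ^ 2
  set P := (1 - r) ^ 2
  set a := polyEval advConst t
  set b := polyEval advSlope t
  have hc : 0 ≤ (1 - t) * (1 + t) ^ 2 := mul_nonneg (by linarith) (by positivity)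
  have hd : 0 ≤ t * (3 - t) := mul_nonneg (by linarith) (by linarith)
  rcases le_total 0 (a + p * b) with h | h
  · have : 0 ≤ p * t * (3 - t) := by rw [mul_assoc]; exact mul_nonneg hp0 hd
    positivity
  · have hN : a + P * b ≤ a + p * b := by nlinarith
    have hpow : p ^ 10 ≤ P ^ 10 := by gcongr
    have hterm : p * P ^ 10 * (a + P * b) ≤ p ^ 11 * (a + p * b) := by
      have h3 : p * P ^ 10 * (a + P * b) ≤ p * P ^ 10 * (a + p * b) := by gcongr
      have h4 : p * P ^ 10 * (a + p * b) ≤ p * p ^ 10 * (a + p * b) :=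
        mul_le_mul_of_nonpos_right (by gcongr) h
      calc _ ≤ _ := h3.trans h4
        _ = _ := by ring
    have hM : p * ((1 - t) * (1 + t) ^ 2 + P * t * (3 - t)) ≤
        P * ((1 - t) * (1 + t) ^ 2 + p * t * (3 - t)) := by
      nlinarith [mul_le_mul_of_nonneg_right hpr hc]
    have hG : 0 ≤ (1 + t) ^ 19 := by positivity
    have h5 := mul_nonneg hp0 hcurve
    have h6 := mul_le_mul_of_nonneg_left hM hG
    have h7 := mul_le_mul_of_nonneg_left hterm hP.le
    refine (mul_nonneg_iff_of_pos_left hP).1 ?_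
    linarith

lemma cleared_nonneg_of_large {p t : ℝ} (hp0 : 0 ≤ p) (hp1 : p ≤ 1 / 5) (h0 : 0.35 ≤ t)
    (h1 : t ≤ 0.5625) :
    0 ≤ 10 ^ 9 * (p ^ 11 * (polyEval advConst t + p * polyEval advSlope t)) +
      8 * ((1 + t) ^ 19 * ((1 - t) * (1 + t) ^ 2 + p * t * (3 - t))) := by
  have hA := neg_six_le_advConst h0 (by linarith)
  have hB := neg_one_le_advSlope h0 (by linarith)
  have hAB : -7 ≤ polyEval advConst t + p * polyEval advSlope t := by nlinarith
  have hpow : p ^ 11 ≤ (1 / 5) ^ 11 := by gcongr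
  have hnum : (1 / 5) ^ 11 * -7 ≤ p ^ 11 * (polyEval advConst t + p * polyEval advSlope t) := by
    nlinarith [mul_le_mul_of_nonneg_left hAB (pow_nonneg hp0 11)]
  have hG : (1.35 : ℝ) ^ 19 ≤ (1 + t) ^ 19 := by gcongr; linarith
  have hM : (0.7 : ℝ) ≤ (1 - t) * (1 + t) ^ 2 + p * t * (3 - t) := by
    have h2 : 0 ≤ p * t * (3 - t) := mul_nonneg (by positivity) (by linarith)
    nlinarith [mul_nonneg (by linarith : 0 ≤ 1 - t) (sq_nonneg (1 + t))]
  have hGM : (1.35 : ℝ) ^ 19 * 0.7 ≤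
      (1 + t) ^ 19 * ((1 - t) * (1 + t) ^ 2 + p * t * (3 - t)) := by gcongr
  norm_num at hnum hGM ⊢
  linarith

end LowerBound

/-- For all `(x, y)` with `0 ≤ x ≤ 0.8`, `0 ≤ y ≤ 0.8` and
`0.5 ≤ x + y ≤ 1.2`, one has `f_11(x, y) ≥ −8 × 10⁻⁹`. -/
theorem soAdv_eleven_lower_bound (x y : ℝ)
    (hx0 : 0 ≤ x) (hx1 : x ≤ 0.8) (hy0 : 0 ≤ y) (hy1 : y ≤ 0.8)
    (hs0 : 0.5 ≤ x + y) (hs1 : x + y ≤ 1.2) :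
    -(8 / 10 ^ 9) ≤ soAdv 11 x y := by
  norm_num at hx1 hy1 hs0 hs1
  obtain ⟨p, hp⟩ : ∃ p, p = x * y := ⟨_, rfl⟩
  obtain ⟨t, ht⟩ : ∃ t, t = (1 - x) * (1 - y) := ⟨_, rfl⟩
  have hts : t = 1 - (x + y) + p := by rw [hp, ht]; ring
  have hp0 : 0 ≤ p := by rw [hp]; positivity
  have hp4 : 4 * p ≤ (x + y) ^ 2 := by rw [hp]; nlinarith [sq_nonneg (x - y)]
  have ht0 : 0.12 ≤ t := by
    norm_num
    nlinarith [mul_nonneg (sub_nonneg.2 hx1) (sub_nonneg.2 hy1)]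
  have hr := Real.sq_sqrt (by linarith : 0 ≤ t)
  have hr0 := Real.sqrt_nonneg t
  have hrs : √t ≤ 1 - (x + y) / 2 := Real.sqrt_le_iff.2 ⟨by linarith, by nlinarith⟩
  set r := √t
  have hpr : p ≤ (1 - r) ^ 2 := by nlinarith
  have ht1 : t ≤ 0.5625 := by norm_num; nlinarith
  have hden : 0 < (1 + t) ^ 19 * ((1 - t) * (1 + t) ^ 2 + p * t * (3 - t)) := by
    have h1 : 0 < 1 - t := by linarith
    have h2 : 0 < 1 + t := by linarith
    have h3 : 0 ≤ p * t * (3 - t) := mul_nonneg (mul_nonneg hp0 (by linarith)) (by linarith)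
    positivity
  rw [soAdv_eleven_eq hx0 (by linarith) hy0 (by linarith) hp ht (by linarith), le_div_iff₀ hden]
  suffices 0 ≤ 10 ^ 9 * (p ^ 11 * (polyEval advConst t + p * polyEval advSlope t)) +
      8 * ((1 + t) ^ 19 * ((1 - t) * (1 + t) ^ 2 + p * t * (3 - t))) by linarith
  rcases lt_or_ge t 0.2 with h2 | h2
  · have := cleared_nonneg_of_small hp0 (by nlinarith) ht0 h2
    positivity
  rcases lt_or_ge t 0.35 with h3 | h3
  · have hr1 : 0.447 ≤ r := Real.le_sqrt_of_sq_le (le_trans (by norm_num) h2)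
    have hr2 : r < 0.592 := (Real.sqrt_lt' (by norm_num)).2 (h3.trans (by norm_num))
    rw [← hr] at h2 h3 ⊢
    exact cleared_nonneg_of_medium hp0 hr1 hr2 h2 h3 hpr
  · have hr1 : 0.59 ≤ r := Real.le_sqrt_of_sq_le (le_trans (by norm_num) h3)
    have hr2 : (1 - r) ^ 2 ≤ (1 - 0.59) ^ 2 := pow_le_pow_left₀ (by linarith) (by linarith) 2
    exact cleared_nonneg_of_large hp0 (hpr.trans (hr2.trans (by norm_num))) h3 ht1
end

section
/- For all p_A, p_B ∈ (0,1), the first-serving team's advantage in a modified rally scoring game to 21 satisfies: f*_21(p_A, p_B) > 0 if p_A + p_B > 1, f*_21(p_A, p_B) < 0 if p_A + p_B < 1, and f*_21(p_A, p_B) = 0 if p_A + p_B = 1. In particular, the first-serving team has an advantage if and only if p_A exceeds 1 − p_B. -/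
/-- The serving team in modified rally scoring. -/
inductive MRSrv : Type
  | A | B
  deriving DecidableEq

/-- States of a modified rally scoring game to `n`: a (capped) score `(i, j)` together
with the serving team, or one of the two absorbing states. -/
inductive MRState (n : ℕ) : Type
  | game (i j : ℕ) (srv : MRSrv)
  | Awins
  | Bwins
  deriving DecidableEq

/-- Result of Team A scoring a point from (capped) score `(i, j)`; Team A serves next. -/
def mrScoreA (n i j : ℕ) : MRState n :=
  if i = n - 1 then
    if j = n - 1 then MRState.game n (n - 1) MRSrv.A
    else if j = n then MRState.game (n - 1) (n - 1) MRSrv.A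
    else MRState.Awins
  else if i = n then MRState.Awins
  else MRState.game (i + 1) j MRSrv.A

/-- Result of Team B scoring a point from (capped) score `(i, j)`; Team B serves next. -/
def mrScoreB (n i j : ℕ) : MRState n :=
  if j = n - 1 then
    if i = n - 1 then MRState.game (n - 1) n MRSrv.B
    else if i = n then MRState.game (n - 1) (n - 1) MRSrv.B
    else MRState.Bwins
  else if j = n then MRState.Bwins
  else MRState.game i (j + 1) MRSrv.B

/-- Under modified-rally point awarding, whether Team A, winning a rally as the
*receiving* team at capped score `(i, j)`, is awarded a point: it must not yet have
reached `n - 1` points, and it must not be the case that the opponent has reached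
`n - 1` points while Team A has reached `n - 3` points. -/
def canRecvScoreA (n i j : ℕ) : Prop := i < n - 1 ∧ ¬(n - 1 ≤ j ∧ n - 3 ≤ i)

/-- Whether Team B, winning a rally as the receiving team at capped score `(i, j)`,
is awarded a point. -/
def canRecvScoreB (n i j : ℕ) : Prop := j < n - 1 ∧ ¬(n - 1 ≤ i ∧ n - 3 ≤ j)

instance (n i j : ℕ) : Decidable (canRecvScoreA n i j) := by
  unfold canRecvScoreA; infer_instance

instance (n i j : ℕ) : Decidable (canRecvScoreB n i j) := by
  unfold canRecvScoreB; infer_instance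

/-- `mrDist n pA pB k s t` : the probability that a modified rally scoring game to `n`
is in state `t` after `k` rallies, starting from state `s`.  The serving team wins the
rally with probability `pA` (resp. `pB`); the winner of the rally serves next; the
winner always scores when it was serving, and scores when it was receiving exactly
when permitted by the modified-rally rules. The absorbing states stay put. -/
def mrDist (n : ℕ) (pA pB : ℝ) : ℕ → MRState n → MRState n → ℝ
  | 0, s, t => if t = s then 1 else 0
  | k + 1, MRState.Awins, t => mrDist n pA pB k MRState.Awins t
  | k + 1, MRState.Bwins, t => mrDist n pA pB k MRState.Bwins t
  | k + 1, MRState.game i j MRSrv.A, t =>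
      pA * mrDist n pA pB k (mrScoreA n i j) t
        + (1 - pA) * mrDist n pA pB k
            (if canRecvScoreB n i j then mrScoreB n i j else MRState.game i j MRSrv.B) t
  | k + 1, MRState.game i j MRSrv.B, t =>
      pB * mrDist n pA pB k (mrScoreB n i j) t
        + (1 - pB) * mrDist n pA pB k
            (if canRecvScoreA n i j then mrScoreA n i j else MRState.game i j MRSrv.A) t

/-- Probability that Team A eventually wins the modified rally scoring game, from `s`. -/
noncomputable def mrWinA (n : ℕ) (pA pB : ℝ) (s : MRState n) : ℝ :=
  ⨆ k : ℕ, mrDist n pA pB k s MRState.Awins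

/-- Probability that Team B eventually wins the modified rally scoring game, from `s`. -/
noncomputable def mrWinB (n : ℕ) (pA pB : ℝ) (s : MRState n) : ℝ :=
  ⨆ k : ℕ, mrDist n pA pB k s MRState.Bwins

/-- The first-serving team's advantage `f*_n(p_A, p_B)` under modified rally scoring:
P(Team A wins | Team A serves first) − P(Team A wins | Team B serves first). -/
noncomputable def mrAdv (n : ℕ) (pA pB : ℝ) : ℝ :=
  mrWinA n pA pB (MRState.game 0 0 MRSrv.A) - mrWinA n pA pB (MRState.game 0 0 MRSrv.B)

/-! ### One-step equations for the winning probability -/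

section OneStep

variable {n : ℕ} {pA pB : ℝ}

theorem mrDist_Awins_Awins (k : ℕ) :
    mrDist n pA pB k MRState.Awins MRState.Awins = 1 := by
  induction k with
  | zero => simp [mrDist]
  | succ k ih => simpa [mrDist] using ih

theorem mrDist_Bwins_Awins (k : ℕ) :
    mrDist n pA pB k MRState.Bwins MRState.Awins = 0 := by
  induction k with
  | zero => simp [mrDist]
  | succ k ih => simpa [mrDist] using ih

theorem mrWinA_Awins : mrWinA n pA pB MRState.Awins = 1 := by
  simp [mrWinA, mrDist_Awins_Awins]

theorem mrWinA_Bwins : mrWinA n pA pB MRState.Bwins = 0 := by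
  simp [mrWinA, mrDist_Bwins_Awins]

theorem mrDist_Awins_mem_Icc (hA : pA ∈ Set.Ioo (0 : ℝ) 1) (hB : pB ∈ Set.Ioo (0 : ℝ) 1)
    (k : ℕ) (s : MRState n) : mrDist n pA pB k s MRState.Awins ∈ Set.Icc (0 : ℝ) 1 := by
  obtain ⟨hA0, hA1⟩ := hA
  obtain ⟨hB0, hB1⟩ := hB
  induction k generalizing s with
  | zero => unfold mrDist; split_ifs <;> simp
  | succ k ih =>
    rcases s with ⟨i, j, _ | _⟩ | _ | _
    · exact convex_Icc (0 : ℝ) 1 (ih _) (ih _) hA0.le (by linarith) (by ring)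
    · exact convex_Icc (0 : ℝ) 1 (ih _) (ih _) hB0.le (by linarith) (by ring)
    · exact ih _
    · exact ih _

theorem mrDist_Awins_monotone (hA : pA ∈ Set.Ioo (0 : ℝ) 1) (hB : pB ∈ Set.Ioo (0 : ℝ) 1)
    (s : MRState n) : Monotone fun k => mrDist n pA pB k s MRState.Awins := by
  have hA1 : 0 ≤ 1 - pA := sub_nonneg.2 hA.2.le
  have hB1 : 0 ≤ 1 - pB := sub_nonneg.2 hB.2.le
  refine monotone_nat_of_le_succ fun k => ?_
  induction k generalizing s with
  | zero =>
    rcases s with ⟨i, j, v⟩ | _ | _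
    · exact le_of_eq_of_le (by simp [mrDist]) (mrDist_Awins_mem_Icc hA hB 1 _).1
    · simp [mrDist]
    · simp [mrDist]
  | succ k ih =>
    rcases s with ⟨i, j, _ | _⟩ | _ | _
    · exact add_le_add (mul_le_mul_of_nonneg_left (ih _) hA.1.le)
        (mul_le_mul_of_nonneg_left (ih _) hA1)
    · exact add_le_add (mul_le_mul_of_nonneg_left (ih _) hB.1.le)
        (mul_le_mul_of_nonneg_left (ih _) hB1)
    · exact ih _
    · exact ih _

theorem bddAbove_mrDist_Awins (hA : pA ∈ Set.Ioo (0 : ℝ) 1) (hB : pB ∈ Set.Ioo (0 : ℝ) 1)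
    (s : MRState n) : BddAbove (Set.range fun k => mrDist n pA pB k s MRState.Awins) :=
  ⟨1, by rintro _ ⟨k, rfl⟩; exact (mrDist_Awins_mem_Icc hA hB k s).2⟩

theorem tendsto_mrDist_Awins (hA : pA ∈ Set.Ioo (0 : ℝ) 1) (hB : pB ∈ Set.Ioo (0 : ℝ) 1)
    (s : MRState n) :
    Filter.Tendsto (fun k => mrDist n pA pB k s MRState.Awins) Filter.atTop
      (nhds (mrWinA n pA pB s)) :=
  tendsto_atTop_ciSup (mrDist_Awins_monotone hA hB s) (bddAbove_mrDist_Awins hA hB s)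

theorem mrWinA_nonneg (hA : pA ∈ Set.Ioo (0 : ℝ) 1) (hB : pB ∈ Set.Ioo (0 : ℝ) 1)
    (s : MRState n) : 0 ≤ mrWinA n pA pB s :=
  ge_of_tendsto' (tendsto_mrDist_Awins hA hB s) fun k => (mrDist_Awins_mem_Icc hA hB k s).1

theorem mrWinA_le_one (hA : pA ∈ Set.Ioo (0 : ℝ) 1) (hB : pB ∈ Set.Ioo (0 : ℝ) 1)
    (s : MRState n) : mrWinA n pA pB s ≤ 1 :=
  le_of_tendsto' (tendsto_mrDist_Awins hA hB s) fun k => (mrDist_Awins_mem_Icc hA hB k s).2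

theorem mrWinA_game_A (hA : pA ∈ Set.Ioo (0 : ℝ) 1) (hB : pB ∈ Set.Ioo (0 : ℝ) 1) (i j : ℕ) :
    mrWinA n pA pB (MRState.game i j MRSrv.A) = pA * mrWinA n pA pB (mrScoreA n i j)
      + (1 - pA) * mrWinA n pA pB
          (if canRecvScoreB n i j then mrScoreB n i j else MRState.game i j MRSrv.B) :=
  tendsto_nhds_unique
    ((Filter.tendsto_add_atTop_iff_nat 1).2 (tendsto_mrDist_Awins hA hB _))
    (((tendsto_mrDist_Awins hA hB _).const_mul pA).add
      ((tendsto_mrDist_Awins hA hB _).const_mul (1 - pA)))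

theorem mrWinA_game_B (hA : pA ∈ Set.Ioo (0 : ℝ) 1) (hB : pB ∈ Set.Ioo (0 : ℝ) 1) (i j : ℕ) :
    mrWinA n pA pB (MRState.game i j MRSrv.B) = pB * mrWinA n pA pB (mrScoreB n i j)
      + (1 - pB) * mrWinA n pA pB
          (if canRecvScoreA n i j then mrScoreA n i j else MRState.game i j MRSrv.A) :=
  tendsto_nhds_unique
    ((Filter.tendsto_add_atTop_iff_nat 1).2 (tendsto_mrDist_Awins hA hB _))
    (((tendsto_mrDist_Awins hA hB _).const_mul pB).add
      ((tendsto_mrDist_Awins hA hB _).const_mul (1 - pB)))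

end OneStep

/-! ### Games to `m + 1` points -/

/-- Probability that Team A wins a game to `m + 1` from score `(i, j)` with `v` serving. -/
noncomputable abbrev winFrom (m : ℕ) (pA pB : ℝ) (i j : ℕ) (v : MRSrv) : ℝ :=
  mrWinA (m + 1) pA pB (MRState.game i j v)

/-- How much better for Team A it is to score the next point from `(i, j)` and serve than to
lose it and receive. -/
noncomputable def pointGain (m : ℕ) (pA pB : ℝ) (i j : ℕ) : ℝ :=
  winFrom m pA pB (i + 1) j MRSrv.A - winFrom m pA pB i (j + 1) MRSrv.B

section Game

variable {m : ℕ} {pA pB : ℝ}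

theorem mrScoreA_of_lt {i : ℕ} (j : ℕ) (h : i < m) :
    mrScoreA (m + 1) i j = MRState.game (i + 1) j MRSrv.A := by
  simp [mrScoreA, h.ne, (h.trans m.lt_succ_self).ne]

theorem mrScoreB_of_lt {j : ℕ} (i : ℕ) (h : j < m) :
    mrScoreB (m + 1) i j = MRState.game i (j + 1) MRSrv.B := by
  simp [mrScoreB, h.ne, (h.trans m.lt_succ_self).ne]

theorem mrScoreA_gamePoint {j : ℕ} (h : j < m) :
    mrScoreA (m + 1) m j = MRState.Awins := by
  simp [mrScoreA, h.ne, (h.trans m.lt_succ_self).ne]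

theorem mrScoreB_gamePoint {i : ℕ} (h : i < m) :
    mrScoreB (m + 1) i m = MRState.Bwins := by
  simp [mrScoreB, h.ne, (h.trans m.lt_succ_self).ne]

theorem winFrom_A_of_lt (hA : pA ∈ Set.Ioo (0 : ℝ) 1) (hB : pB ∈ Set.Ioo (0 : ℝ) 1)
    {i j : ℕ} (hi : i < m) (hj : j < m) :
    winFrom m pA pB i j MRSrv.A = pA * winFrom m pA pB (i + 1) j MRSrv.A
      + (1 - pA) * winFrom m pA pB i (j + 1) MRSrv.B := by
  have h : canRecvScoreB (m + 1) i j := by unfold canRecvScoreB; omega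
  rw [winFrom, mrWinA_game_A hA hB, if_pos h, mrScoreA_of_lt j hi, mrScoreB_of_lt i hj]

theorem winFrom_B_of_lt (hA : pA ∈ Set.Ioo (0 : ℝ) 1) (hB : pB ∈ Set.Ioo (0 : ℝ) 1)
    {i j : ℕ} (hi : i < m) (hj : j < m) :
    winFrom m pA pB i j MRSrv.B = pB * winFrom m pA pB i (j + 1) MRSrv.B
      + (1 - pB) * winFrom m pA pB (i + 1) j MRSrv.A := by
  have h : canRecvScoreA (m + 1) i j := by unfold canRecvScoreA; omega
  rw [winFrom, mrWinA_game_B hA hB, if_pos h, mrScoreA_of_lt j hi, mrScoreB_of_lt i hj]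

theorem winFrom_gamePointA_A_of_add_two_lt (hA : pA ∈ Set.Ioo (0 : ℝ) 1) (hB : pB ∈ Set.Ioo (0 : ℝ) 1)
    {j : ℕ} (hj : j + 2 < m) :
    winFrom m pA pB m j MRSrv.A = pA + (1 - pA) * winFrom m pA pB m (j + 1) MRSrv.B := by
  have h : canRecvScoreB (m + 1) m j := by unfold canRecvScoreB; omega
  rw [winFrom, mrWinA_game_A hA hB, if_pos h, mrScoreA_gamePoint (by omega),
    mrScoreB_of_lt m (by omega), mrWinA_Awins, mul_one]

theorem winFrom_gamePointA_A_of_le_add_two (hA : pA ∈ Set.Ioo (0 : ℝ) 1) (hB : pB ∈ Set.Ioo (0 : ℝ) 1)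
    {j : ℕ} (hj : j < m) (hm : m ≤ j + 2) :
    winFrom m pA pB m j MRSrv.A = pA + (1 - pA) * winFrom m pA pB m j MRSrv.B := by
  have h : ¬ canRecvScoreB (m + 1) m j := by unfold canRecvScoreB; omega
  rw [winFrom, mrWinA_game_A hA hB, if_neg h, mrScoreA_gamePoint hj, mrWinA_Awins, mul_one]

theorem winFrom_gamePointA_B (hA : pA ∈ Set.Ioo (0 : ℝ) 1) (hB : pB ∈ Set.Ioo (0 : ℝ) 1)
    {j : ℕ} (hj : j < m) :
    winFrom m pA pB m j MRSrv.B = pB * winFrom m pA pB m (j + 1) MRSrv.B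
      + (1 - pB) * winFrom m pA pB m j MRSrv.A := by
  have h : ¬ canRecvScoreA (m + 1) m j := by unfold canRecvScoreA; omega
  rw [winFrom, mrWinA_game_B hA hB, if_neg h, mrScoreB_of_lt m hj]

theorem winFrom_gamePointB_B_of_add_two_lt (hA : pA ∈ Set.Ioo (0 : ℝ) 1) (hB : pB ∈ Set.Ioo (0 : ℝ) 1)
    {i : ℕ} (hi : i + 2 < m) :
    winFrom m pA pB i m MRSrv.B = (1 - pB) * winFrom m pA pB (i + 1) m MRSrv.A := by
  have h : canRecvScoreA (m + 1) i m := by unfold canRecvScoreA; omega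
  rw [winFrom, mrWinA_game_B hA hB, if_pos h, mrScoreB_gamePoint (by omega),
    mrScoreA_of_lt m (by omega), mrWinA_Bwins, mul_zero, zero_add]

theorem winFrom_gamePointB_B_of_le_add_two (hA : pA ∈ Set.Ioo (0 : ℝ) 1) (hB : pB ∈ Set.Ioo (0 : ℝ) 1)
    {i : ℕ} (hi : i < m) (hm : m ≤ i + 2) :
    winFrom m pA pB i m MRSrv.B = (1 - pB) * winFrom m pA pB i m MRSrv.A := by
  have h : ¬ canRecvScoreA (m + 1) i m := by unfold canRecvScoreA; omega
  rw [winFrom, mrWinA_game_B hA hB, if_neg h, mrScoreB_gamePoint hi, mrWinA_Bwins, mul_zero,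
    zero_add]

theorem winFrom_gamePointB_A (hA : pA ∈ Set.Ioo (0 : ℝ) 1) (hB : pB ∈ Set.Ioo (0 : ℝ) 1)
    {i : ℕ} (hi : i < m) :
    winFrom m pA pB i m MRSrv.A = pA * winFrom m pA pB (i + 1) m MRSrv.A
      + (1 - pA) * winFrom m pA pB i m MRSrv.B := by
  have h : ¬ canRecvScoreB (m + 1) i m := by unfold canRecvScoreB; omega
  rw [winFrom, mrWinA_game_A hA hB, if_neg h, mrScoreA_of_lt m hi]

/-- At game point for Team A, a further point for Team B does not help Team A. -/
theorem winFrom_gamePointA_antitone (hA : pA ∈ Set.Ioo (0 : ℝ) 1) (hB : pB ∈ Set.Ioo (0 : ℝ) 1)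
    {j : ℕ} (hj : j + 1 < m) :
    winFrom m pA pB m (j + 1) MRSrv.A ≤ winFrom m pA pB m j MRSrv.A := by
  have hx : 0 ≤ 1 - pA := sub_nonneg.2 hA.2.le
  have hy : 0 < 1 - pB := sub_pos.2 hB.2
  rcases lt_trichotomy (j + 3) m with h | h | h
  · rw [winFrom_gamePointA_A_of_add_two_lt hA hB (by omega : j + 2 < m),
      winFrom_gamePointA_A_of_add_two_lt hA hB (by omega : j + 1 + 2 < m),
      winFrom_gamePointA_B hA hB (by omega : j + 1 < m),
      winFrom_gamePointA_A_of_add_two_lt hA hB (by omega : j + 1 + 2 < m)]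
    have h1 := mrWinA_le_one hA hB (MRState.game (n := m + 1) m (j + 1 + 1) MRSrv.B)
    refine add_le_add le_rfl (mul_le_mul_of_nonneg_left ?_ hx)
    nlinarith [mul_nonneg (mul_nonneg hy.le hA.1.le) (sub_nonneg.2 h1)]
  · rw [winFrom_gamePointA_A_of_add_two_lt hA hB (by omega : j + 2 < m),
      winFrom_gamePointA_A_of_le_add_two hA hB hj (by omega)]
  · have ha := winFrom_gamePointA_A_of_le_add_two hA hB (by omega : j < m) (by omega)
    have hb := winFrom_gamePointA_B hA hB (by omega : j < m)
    rw [ha, winFrom_gamePointA_A_of_le_add_two hA hB hj (by omega)]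
    have h1 := mrWinA_le_one hA hB (MRState.game (n := m + 1) m (j + 1) MRSrv.B)
    refine add_le_add le_rfl (mul_le_mul_of_nonneg_left ?_ hx)
    rw [ha] at hb
    have hd : 0 < 1 - (1 - pB) * (1 - pA) := by nlinarith [hA.1, hB.1, hA.2]
    refine le_of_mul_le_mul_left ?_ hd
    nlinarith [mul_nonneg (mul_nonneg hy.le hA.1.le) (sub_nonneg.2 h1)]

/-- At game point for Team B, a further point for Team A does not hurt Team A. -/
theorem winFrom_gamePointB_monotone (hA : pA ∈ Set.Ioo (0 : ℝ) 1) (hB : pB ∈ Set.Ioo (0 : ℝ) 1)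
    {i : ℕ} (hi : i + 1 < m) :
    winFrom m pA pB i m MRSrv.B ≤ winFrom m pA pB (i + 1) m MRSrv.B := by
  have hx : 0 < 1 - pA := sub_pos.2 hA.2
  have hy : 0 ≤ 1 - pB := sub_nonneg.2 hB.2.le
  rcases lt_trichotomy (i + 3) m with h | h | h
  · rw [winFrom_gamePointB_B_of_add_two_lt hA hB (by omega : i + 2 < m),
      winFrom_gamePointB_B_of_add_two_lt hA hB (by omega : i + 1 + 2 < m),
      winFrom_gamePointB_A hA hB (by omega : i + 1 < m),
      winFrom_gamePointB_B_of_add_two_lt hA hB (by omega : i + 1 + 2 < m)]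
    have h0 := mrWinA_nonneg hA hB (MRState.game (n := m + 1) (i + 1 + 1) m MRSrv.A)
    refine mul_le_mul_of_nonneg_left ?_ hy
    nlinarith [mul_nonneg (mul_nonneg hx.le hB.1.le) h0]
  · rw [winFrom_gamePointB_B_of_add_two_lt hA hB (by omega : i + 2 < m),
      winFrom_gamePointB_B_of_le_add_two hA hB hi (by omega)]
  · have hc := winFrom_gamePointB_B_of_le_add_two hA hB (by omega : i < m) (by omega)
    have he := winFrom_gamePointB_A hA hB (by omega : i < m)
    rw [hc, winFrom_gamePointB_B_of_le_add_two hA hB hi (by omega)]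
    have h0 := mrWinA_nonneg hA hB (MRState.game (n := m + 1) (i + 1) m MRSrv.A)
    refine mul_le_mul_of_nonneg_left ?_ hy
    rw [hc] at he
    have hd : 0 < 1 - (1 - pA) * (1 - pB) := by nlinarith [hA.1, hB.1, hA.2]
    refine le_of_mul_le_mul_left ?_ hd
    nlinarith [mul_nonneg (mul_nonneg hx.le hB.1.le) h0]

theorem pointGain_corner_pos (hA : pA ∈ Set.Ioo (0 : ℝ) 1) (hB : pB ∈ Set.Ioo (0 : ℝ) 1)
    (d : ℕ) : 0 < pointGain (d + 1) pA pB d d := by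
  have hu := winFrom_gamePointA_A_of_le_add_two hA hB (by omega : d < d + 1) (by omega)
  have hv := winFrom_gamePointA_B hA hB (by omega : d < d + 1)
  have hs := winFrom_gamePointB_A hA hB (by omega : d < d + 1)
  have ht := winFrom_gamePointB_B_of_le_add_two hA hB (by omega : d < d + 1) (by omega)
  have h0 := mrWinA_nonneg hA hB (MRState.game (n := d + 1 + 1) (d + 1) (d + 1) MRSrv.B)
  have h1 := mrWinA_le_one hA hB (MRState.game (n := d + 1 + 1) (d + 1) (d + 1) MRSrv.A)
  rw [hv] at hu
  rw [ht] at hs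
  obtain ⟨hA0, hA1⟩ := hA
  obtain ⟨hB0, hB1⟩ := hB
  have hd : 0 < 1 - (1 - pA) * (1 - pB) := by nlinarith
  rw [pointGain, ht]
  refine pos_of_mul_pos_right (a := 1 - (1 - pA) * (1 - pB)) ?_ hd.le
  have e : (1 - (1 - pA) * (1 - pB)) * (winFrom (d + 1) pA pB (d + 1) d MRSrv.A
        - (1 - pB) * winFrom (d + 1) pA pB d (d + 1) MRSrv.A)
      = pA * pB + (1 - pA) * pB * winFrom (d + 1) pA pB (d + 1) (d + 1) MRSrv.B
        + (1 - pB) * pA * (1 - winFrom (d + 1) pA pB (d + 1) (d + 1) MRSrv.A) := by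
    linear_combination hu - (1 - pB) * hs
  rw [e]
  have := mul_nonneg (mul_nonneg (sub_nonneg.2 hA1.le) hB0.le) h0
  have := mul_nonneg (mul_nonneg (sub_nonneg.2 hB1.le) hA0.le) (sub_nonneg.2 h1)
  have := mul_pos hA0 hB0
  linarith

theorem pointGain_right_pos (hA : pA ∈ Set.Ioo (0 : ℝ) 1) (hB : pB ∈ Set.Ioo (0 : ℝ) 1)
    {d j : ℕ} (hj : j ≤ d) : 0 < pointGain (d + 1) pA pB d j := by
  induction hj using Nat.decreasingInduction with
  | self => exact pointGain_corner_pos hA hB d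
  | of_succ j hj ih =>
    have h1 := winFrom_gamePointA_antitone hA hB (by omega : j + 1 < d + 1)
    have h2 := winFrom_B_of_lt hA hB (by omega : d < d + 1) (by omega : j + 1 < d + 1)
    rw [pointGain] at ih ⊢
    linarith [mul_pos hB.1 ih]

theorem pointGain_sub_mul_top_nonneg (hA : pA ∈ Set.Ioo (0 : ℝ) 1) (hB : pB ∈ Set.Ioo (0 : ℝ) 1)
    {d i : ℕ} (hi : i < d) :
    0 ≤ pointGain (d + 1) pA pB i d - pA * pointGain (d + 1) pA pB (i + 1) d := by
  have h1 := winFrom_gamePointB_monotone hA hB (by omega : i + 1 < d + 1)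
  have h2 := winFrom_A_of_lt hA hB (by omega : i + 1 < d + 1) (by omega : d < d + 1)
  rw [pointGain, pointGain]
  linarith

theorem winFrom_A_sub_winFrom_B (hA : pA ∈ Set.Ioo (0 : ℝ) 1) (hB : pB ∈ Set.Ioo (0 : ℝ) 1)
    {i j : ℕ} (hi : i < m) (hj : j < m) :
    winFrom m pA pB i j MRSrv.A - winFrom m pA pB i j MRSrv.B
      = (pA + pB - 1) * pointGain m pA pB i j := by
  rw [pointGain]
  linear_combination winFrom_A_of_lt hA hB hi hj - winFrom_B_of_lt hA hB hi hj

theorem pointGain_recursion (hA : pA ∈ Set.Ioo (0 : ℝ) 1) (hB : pB ∈ Set.Ioo (0 : ℝ) 1)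
    {i j : ℕ} (hi : i + 1 < m) (hj : j + 1 < m) :
    pointGain m pA pB i j - pA * pointGain m pA pB (i + 1) j
      = pB * (pointGain m pA pB i (j + 1) - pA * pointGain m pA pB (i + 1) (j + 1))
        + (1 - pA) * (1 - pB) * pointGain m pA pB (i + 1) (j + 1) := by
  have h1 := winFrom_A_sub_winFrom_B hA hB hi hj
  have h2 := winFrom_A_of_lt hA hB hi (by omega : j < m)
  have h3 := winFrom_B_of_lt hA hB (by omega : i < m) hj
  simp only [pointGain] at h1 ⊢
  linear_combination h2 - h3 - h1

theorem pointGain_pos (hA : pA ∈ Set.Ioo (0 : ℝ) 1) (hB : pB ∈ Set.Ioo (0 : ℝ) 1)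
    {d i j : ℕ} (hi : i ≤ d) (hj : j ≤ d) : 0 < pointGain (d + 1) pA pB i j := by
  have pos_of_sub_nonneg : ∀ {j : ℕ}, j ≤ d →
      (∀ i < d, 0 ≤ pointGain (d + 1) pA pB i j - pA * pointGain (d + 1) pA pB (i + 1) j) →
      ∀ i ≤ d, 0 < pointGain (d + 1) pA pB i j := by
    intro j hj h i hi
    induction hi using Nat.decreasingInduction with
    | self => exact pointGain_right_pos hA hB hj
    | of_succ i hi ih => linarith [h i hi, mul_pos hA.1 ih]
  refine pos_of_sub_nonneg hj ?_ i hi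
  induction hj using Nat.decreasingInduction with
  | self => exact fun i hi => pointGain_sub_mul_top_nonneg hA hB hi
  | of_succ j hj ih =>
    intro i hi
    rw [pointGain_recursion hA hB (by omega) (by omega)]
    exact add_nonneg (mul_nonneg hB.1.le (ih i hi))
      (mul_nonneg (mul_nonneg (sub_nonneg.2 hA.2.le) (sub_nonneg.2 hB.2.le))
        (pos_of_sub_nonneg hj ih (i + 1) hi).le)

/-- The first-serving advantage is a positive multiple of `pA + pB - 1`. -/
theorem exists_pos_mrAdv_eq_mul (hA : pA ∈ Set.Ioo (0 : ℝ) 1) (hB : pB ∈ Set.Ioo (0 : ℝ) 1)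
    (d : ℕ) : ∃ c : ℝ, 0 < c ∧ mrAdv (d + 1 + 1) pA pB = (pA + pB - 1) * c :=
  ⟨pointGain (d + 1) pA pB 0 0, pointGain_pos hA hB d.zero_le d.zero_le,
    winFrom_A_sub_winFrom_B hA hB d.succ_pos d.succ_pos⟩

end Game

/-- For all `p_A, p_B ∈ (0,1)`, the first-serving team's advantage under
modified rally scoring to 21 is positive if `p_A + p_B > 1`, negative if
`p_A + p_B < 1`, and zero if `p_A + p_B = 1`; in particular, the first-serving team has
an advantage if and only if `p_A > 1 − p_B`. -/
theorem mrAdv_twentyone_sign (pA pB : ℝ)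
    (hA : pA ∈ Set.Ioo (0 : ℝ) 1) (hB : pB ∈ Set.Ioo (0 : ℝ) 1) :
    (1 < pA + pB → 0 < mrAdv 21 pA pB)
      ∧ (pA + pB < 1 → mrAdv 21 pA pB < 0)
      ∧ (pA + pB = 1 → mrAdv 21 pA pB = 0)
      ∧ (0 < mrAdv 21 pA pB ↔ 1 - pB < pA) := by
  obtain ⟨c, hc, h⟩ := exists_pos_mrAdv_eq_mul hA hB 19
  have h21 : mrAdv 21 pA pB = (pA + pB - 1) * c := h
  rw [h21]
  refine ⟨fun h => mul_pos (by linarith) hc, fun h => mul_neg_of_neg_of_pos (by linarith) hc,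
    fun h => by rw [h, sub_self, zero_mul], ?_⟩
  rw [mul_pos_iff_of_pos_right hc]
  constructor <;> intro h <;> linarith
end
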